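/- arXiv:math/9908091 — 3 statements merged into one kernel-verified Lean document; each statement's English description precedes it below -/
import Mathlib

section
/- Let A be a unital C*-algebra and let x, y ∈ A be self-adjoint elements. Then 1 + x² and 1 + y² are invertible in A, and in the order of A (given by the cone of positive elements) one has −2 · max{ ‖y − x‖², ‖y − x‖ } · (1 + x²)^{−1} ≤ (1 + y²)^{−1} − (1 + x²)^{−1} ≤ 2 · max{ ‖y − x‖², ‖y − x‖ } · (1 + x²)^{−1}. -/
section Aux
variable {A : Type*} [CStarAlgebra A] [PartialOrder A] [StarOrderedRing A]

theorem aux_pos {x : A} (hx : IsSelfAdjoint x) : IsStrictlyPositive (1 + x ^ 2) := by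
  have h : (1 : A) ≤ 1 + x ^ 2 := le_add_of_nonneg_right hx.sq_nonneg
  exact IsStrictlyPositive.of_le isStrictlyPositive_one h

theorem aux_le {x y : A} (hx : IsSelfAdjoint x) (hy : IsSelfAdjoint y) {t : ℝ} (ht : 0 < t)
    (h : (1 + t⁻¹) * ‖y - x‖ ^ 2 ≤ t) : 1 + x ^ 2 ≤ (1 + t) • (1 + y ^ 2) := by
  have hd : IsSelfAdjoint (y - x) := hy.sub hx
  have h1 : (y - x) ^ 2 ≤ (‖y - x‖ ^ 2) • (1 : A) := by
    have := CStarAlgebra.star_mul_le_algebraMap_norm_sq (a := y - x)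
    rwa [hd.star_eq, ← sq, Algebra.algebraMap_eq_smul_one] at this
  have h2 : 0 ≤ (t • y + (y - x)) ^ 2 :=
    (((IsSelfAdjoint.all t).smul hy).add hd).sq_nonneg
  have h3 : 0 ≤ t⁻¹ • (t • y + (y - x)) ^ 2 := smul_nonneg (by positivity) h2
  have h4 : 0 ≤ (1 + t⁻¹) • ((‖y - x‖ ^ 2) • (1 : A) - (y - x) ^ 2) :=
    smul_nonneg (by positivity) (sub_nonneg.2 h1)
  have h5 : 0 ≤ (t - (1 + t⁻¹) * ‖y - x‖ ^ 2) • (1 : A) :=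
    smul_nonneg (sub_nonneg.2 h) zero_le_one
  rw [← sub_nonneg]
  have key : (1 + t) • (1 + y ^ 2) - (1 + x ^ 2) = t⁻¹ • (t • y + (y - x)) ^ 2
      + (1 + t⁻¹) • ((‖y - x‖ ^ 2) • (1 : A) - (y - x) ^ 2)
      + (t - (1 + t⁻¹) * ‖y - x‖ ^ 2) • (1 : A) := by
    generalize ‖y - x‖ ^ 2 = s
    simp only [sq, mul_add, add_mul, mul_sub, sub_mul, smul_mul_assoc, mul_smul_comm]
    match_scalars <;> field_simp <;> ring
  rw [key]
  exact add_nonneg (add_nonneg h3 h4) h5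

theorem aux_inv {x y : A} (hx : IsSelfAdjoint x) (hy : IsSelfAdjoint y) :
    Ring.inverse (1 + y ^ 2) ≤
      (1 + 2 * max (‖y - x‖ ^ 2) ‖y - x‖) • Ring.inverse (1 + x ^ 2) := by
  by_cases h0 : y - x = 0
  · rw [sub_eq_zero.1 h0]; simp
  have hδ : 0 < ‖y - x‖ := norm_pos_iff.2 h0
  have hle : 1 + x ^ 2 ≤ (1 + 2 * max (‖y - x‖ ^ 2) ‖y - x‖) • (1 + y ^ 2) := by
    have hm : 0 < max (‖y - x‖ ^ 2) ‖y - x‖ := lt_max_of_lt_right hδ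
    apply aux_le hx hy (by positivity)
    have e1 := le_max_left (‖y - x‖ ^ 2) ‖y - x‖
    have e2 := le_max_right (‖y - x‖ ^ 2) ‖y - x‖
    generalize max (‖y - x‖ ^ 2) ‖y - x‖ = m at *
    have : ‖y - x‖ ^ 2 ≤ m ^ 2 := by gcongr
    have h3 : (2 * m)⁻¹ * ‖y - x‖ ^ 2 ≤ (2 * m)⁻¹ * m ^ 2 := by gcongr
    have h4 : (2 * m)⁻¹ * m ^ 2 = m / 2 := by field_simp
    linarith
  have hc : 0 < 1 + 2 * max (‖y - x‖ ^ 2) ‖y - x‖ := by positivity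
  generalize 1 + 2 * max (‖y - x‖ ^ 2) ‖y - x‖ = c at *
  have hb := aux_pos hy
  have ha := aux_pos hx
  have hcb : IsStrictlyPositive (c • (1 + y ^ 2)) := IsStrictlyPositive.of_le ha hle
  have h := CStarAlgebra.antitoneOn_ringInverse (A := A) ha hcb hle
  have e : Ring.inverse (1 + y ^ 2) = c • Ring.inverse (c • (1 + y ^ 2)) := by
    have := Ring.inverse_mul_cancel _ hcb.isUnit
    calc _ = (Ring.inverse (c • (1 + y ^ 2)) * (c • (1 + y ^ 2))) * Ring.inverse (1 + y ^ 2) := by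
          rw [this, one_mul]
      _ = _ := by
          rw [mul_assoc, smul_mul_assoc, Ring.mul_inverse_cancel _ hb.isUnit, mul_smul_comm,
            mul_one]
  rw [e]
  exact smul_le_smul_of_nonneg_left h hc.le

theorem aux_nonneg {x : A} (hx : IsSelfAdjoint x) : 0 ≤ Ring.inverse (1 + x ^ 2) := by
  have ha := aux_pos hx
  rw [Ring.inverse_of_isUnit ha.isUnit]
  exact CFC.inv_nonneg_of_nonneg _ ha.nonneg

theorem aux_main {x y : A} (hx : IsSelfAdjoint x) (hy : IsSelfAdjoint y) :
    IsUnit (1 + x ^ 2) ∧ IsUnit (1 + y ^ 2) ∧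
      -((2 * max (‖y - x‖ ^ 2) ‖y - x‖) • Ring.inverse (1 + x ^ 2)) ≤
          Ring.inverse (1 + y ^ 2) - Ring.inverse (1 + x ^ 2) ∧
        Ring.inverse (1 + y ^ 2) - Ring.inverse (1 + x ^ 2) ≤
          (2 * max (‖y - x‖ ^ 2) ‖y - x‖) • Ring.inverse (1 + x ^ 2) := by
  refine ⟨(aux_pos hx).isUnit, (aux_pos hy).isUnit, ?_, ?_⟩
  · have h := aux_inv hy hx
    rw [norm_sub_rev] at h
    have hm : 0 ≤ max (‖y - x‖ ^ 2) ‖y - x‖ := le_max_of_le_right (norm_nonneg _)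
    generalize max (‖y - x‖ ^ 2) ‖y - x‖ = m at *
    have pa := aux_nonneg hx
    have pb := aux_nonneg hy
    generalize Ring.inverse (1 + x ^ 2) = a at *
    generalize Ring.inverse (1 + y ^ 2) = b at *
    rw [← sub_nonneg]
    rcases le_total (2 * m) 1 with h1 | h1
    · have h2 := smul_nonneg (sub_nonneg.2 h1) (sub_nonneg.2 h)
      have h3 : 0 ≤ (4 * m ^ 2) • b := smul_nonneg (by positivity) pb
      have : b - a - -((2 * m) • a) =
          (1 - 2 * m) • ((1 + 2 * m) • b - a) + (4 * m ^ 2) • b := by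
        module
      rw [this]; exact add_nonneg h2 h3
    · have h2 := smul_nonneg (sub_nonneg.2 h1) pa
      have : b - a - -((2 * m) • a) = (2 * m - 1) • a + b := by module
      rw [this]; exact add_nonneg h2 pb
  · have h := aux_inv hx hy
    rw [add_smul, one_smul] at h
    rw [sub_le_iff_le_add']; exact h

end Aux

/-- Let `A` be a unital C*-algebra (with its canonical partial order given by the positive
cone, expressed via `[PartialOrder A] [StarOrderedRing A]`) and let `x, y ∈ A` be
self-adjoint.  Then `1 + x²` and `1 + y²` are invertible and
`−2 max{‖y − x‖², ‖y − x‖} (1 + x²)⁻¹ ≤ (1 + y²)⁻¹ − (1 + x²)⁻¹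
  ≤ 2 max{‖y − x‖², ‖y − x‖} (1 + x²)⁻¹`. -/
theorem statement9 (A : Type*) [NormedRing A] [StarRing A] [CStarRing A]
    [NormedAlgebra ℂ A] [CompleteSpace A] [StarModule ℂ A]
    [PartialOrder A] [StarOrderedRing A]
    (x y : A) (hx : IsSelfAdjoint x) (hy : IsSelfAdjoint y) :
    IsUnit (1 + x ^ 2) ∧ IsUnit (1 + y ^ 2) ∧
      -((2 * max (‖y - x‖ ^ 2) ‖y - x‖) • Ring.inverse (1 + x ^ 2)) ≤
          Ring.inverse (1 + y ^ 2) - Ring.inverse (1 + x ^ 2) ∧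
        Ring.inverse (1 + y ^ 2) - Ring.inverse (1 + x ^ 2) ≤
          (2 * max (‖y - x‖ ^ 2) ‖y - x‖) • Ring.inverse (1 + x ^ 2) := by

  let : CStarAlgebra A := {}
  exact aux_main hx hy
end

section
/- Let H be a complex Hilbert space and let D₀ be a densely defined self-adjoint operator on H (i.e., D₀ coincides with its Hilbert-space adjoint D₀*). Let a : H → H be a bounded linear operator such that a(dom D₀) ⊆ dom D₀ and suppose there exists a bounded linear operator b : H → H with bξ = D₀(aξ) − a(D₀ξ) for all ξ ∈ dom D₀. Then the adjoint a* also satisfies a*(dom D₀) ⊆ dom D₀, and D₀(a*ξ) − a*(D₀ξ) = −b*ξ for all ξ ∈ dom D₀. -/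
/-- Let `H` be a complex Hilbert space and `D₀` a densely defined self-adjoint operator on
`H` (that is, `D₀.adjoint = D₀` as partially defined linear maps).  Let `a` be a bounded
operator with `a (dom D₀) ⊆ dom D₀` such that the commutator `[D₀, a]` is (given by) a
bounded operator `b`, i.e. `b ξ = D₀ (a ξ) − a (D₀ ξ)` on `dom D₀`.  Then the adjoint `a*`
also preserves `dom D₀` and `D₀ (a* ξ) − a* (D₀ ξ) = −(b* ξ)` on `dom D₀`. -/
theorem statement16 {H : Type*} [NormedAddCommGroup H] [InnerProductSpace ℂ H]
    [CompleteSpace H]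
    (D₀ : H →ₗ.[ℂ] H) (hdense : Dense (D₀.domain : Set H))
    (hsa : D₀.adjoint = D₀)
    (a b : H →L[ℂ] H)
    (ha : ∀ ξ : D₀.domain, a ξ ∈ D₀.domain)
    (hb : ∀ ξ : D₀.domain, b ξ = D₀ ⟨a ξ, ha ξ⟩ - a (D₀ ξ)) :
    ∃ hstar : ∀ ξ : D₀.domain, ContinuousLinearMap.adjoint a ξ ∈ D₀.domain,
      ∀ ξ : D₀.domain,
        D₀ ⟨ContinuousLinearMap.adjoint a ξ, hstar ξ⟩ -
            ContinuousLinearMap.adjoint a (D₀ ξ) =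
          -(ContinuousLinearMap.adjoint b ξ) := by
  have hF : D₀.IsFormalAdjoint D₀ := by
    have h := LinearPMap.adjoint_isFormalAdjoint hdense
    rwa [hsa] at h
  have key : ∀ y w : H, (∀ x : D₀.domain, inner ℂ w (x : H) = inner ℂ y (D₀ x)) →
      ∃ h : y ∈ D₀.domain, D₀ ⟨y, h⟩ = w := by
    have aux : ∀ S : H →ₗ.[ℂ] H, D₀.adjoint = S → ∀ y w : H,
        (∀ x : D₀.domain, inner ℂ w (x : H) = inner ℂ y (D₀ x)) →
        ∃ h : y ∈ S.domain, S ⟨y, h⟩ = w := by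
      rintro S rfl y w hw
      exact ⟨LinearPMap.mem_adjoint_domain_of_exists y ⟨w, hw⟩,
        LinearPMap.adjoint_apply_eq hdense _ hw⟩
    exact aux D₀ hsa
  have main : ∀ ξ : D₀.domain, ∃ h : ContinuousLinearMap.adjoint a ξ ∈ D₀.domain,
      D₀ ⟨ContinuousLinearMap.adjoint a ξ, h⟩ =
        ContinuousLinearMap.adjoint a (D₀ ξ) - ContinuousLinearMap.adjoint b ξ := by
    intro ξ
    apply key
    intro x
    have h1 := hF ξ ⟨a x, ha x⟩
    simp only at h1
    rw [inner_sub_left, ContinuousLinearMap.adjoint_inner_left,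
      ContinuousLinearMap.adjoint_inner_left, ContinuousLinearMap.adjoint_inner_left,
      hb x, inner_sub_right, h1]
    ring
  refine ⟨fun ξ => (main ξ).1, fun ξ => ?_⟩
  rw [(main ξ).2]
  abel
end

section
/- Let H be a complex Hilbert space and let D₀ be a densely defined self-adjoint operator on H (i.e., D₀ coincides with its Hilbert-space adjoint D₀*). Let (a_n) be a sequence of bounded linear operators on H such that each a_n satisfies a_n(dom D₀) ⊆ dom D₀ and there is a bounded operator b_n with b_nξ = D₀(a_nξ) − a_n(D₀ξ) for all ξ ∈ dom D₀. Suppose a_n → a and b_n → b in operator norm for some bounded operators a and b. Then a(dom D₀) ⊆ dom D₀ and D₀(aξ) − a(D₀ξ) = bξ for all ξ ∈ dom D₀. -/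
/-- Let `H` be a complex Hilbert space and `D₀` a densely defined self-adjoint operator on
`H` (that is, `D₀.adjoint = D₀` as partially defined linear maps).  Let `(aₘ)` be a sequence
of bounded operators, each preserving `dom D₀` and with `[D₀, aₘ]` given by a bounded
operator `bₘ` on `dom D₀`.  If `aₘ → a` and `bₘ → b` in operator norm, then `a` preserves
`dom D₀` and `D₀ (a ξ) − a (D₀ ξ) = b ξ` on `dom D₀`. -/
theorem statement17 {H : Type*} [NormedAddCommGroup H] [InnerProductSpace ℂ H]
    [CompleteSpace H]
    (D₀ : H →ₗ.[ℂ] H) (hdense : Dense (D₀.domain : Set H))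
    (hsa : D₀.adjoint = D₀)
    (aseq bseq : ℕ → H →L[ℂ] H) (a b : H →L[ℂ] H)
    (ha : ∀ m, ∀ ξ : D₀.domain, aseq m ξ ∈ D₀.domain)
    (hb : ∀ m, ∀ ξ : D₀.domain, bseq m ξ = D₀ ⟨aseq m ξ, ha m ξ⟩ - aseq m (D₀ ξ))
    (halim : Filter.Tendsto aseq Filter.atTop (nhds a))
    (hblim : Filter.Tendsto bseq Filter.atTop (nhds b)) :
    ∃ hmem : ∀ ξ : D₀.domain, a ξ ∈ D₀.domain,
      ∀ ξ : D₀.domain, D₀ ⟨a ξ, hmem ξ⟩ - a (D₀ ξ) = b ξ := by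
  have hcl : D₀.IsClosed := by
    have h := LinearPMap.adjoint_isClosed hdense
    rwa [hsa] at h
  have happ : ∀ (u : ℕ → H →L[ℂ] H) (v : H →L[ℂ] H),
      Filter.Tendsto u Filter.atTop (nhds v) → ∀ x : H,
      Filter.Tendsto (fun m => u m x) Filter.atTop (nhds (v x)) := fun u v h x =>
    ((ContinuousLinearMap.apply ℂ H x).continuous.tendsto v).comp h
  have key : ∀ ξ : D₀.domain, ((a ξ, b ξ + a (D₀ ξ)) : H × H) ∈ D₀.graph := by
    intro ξ
    have ht : Filter.Tendsto
        (fun m => ((aseq m ξ, bseq m ξ + aseq m (D₀ ξ)) : H × H)) Filter.atTop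
        (nhds (a ξ, b ξ + a (D₀ ξ))) :=
      (happ _ _ halim ξ).prodMk_nhds ((happ _ _ hblim ξ).add (happ _ _ halim (D₀ ξ)))
    refine IsClosed.mem_of_tendsto hcl ht (Filter.Eventually.of_forall fun m => ?_)
    have h := D₀.mem_graph ⟨aseq m ξ, ha m ξ⟩
    have e : bseq m ξ + aseq m (D₀ ξ) = D₀ ⟨aseq m ξ, ha m ξ⟩ := by
      rw [hb m ξ, sub_add_cancel]
    simp only [e]
    exact h
  have hmem : ∀ ξ : D₀.domain, a ξ ∈ D₀.domain := fun ξ =>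
    LinearPMap.mem_domain_of_mem_graph (key ξ)
  refine ⟨hmem, fun ξ => ?_⟩
  obtain ⟨y, hy1, hy2⟩ := (LinearPMap.mem_graph_iff D₀).1 (key ξ)
  have e : (⟨a ξ, hmem ξ⟩ : D₀.domain) = y := Subtype.ext hy1.symm
  rw [e, hy2]
  simp
end
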